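/- arXiv:2301.07435 — 3 statements merged into one kernel-verified Lean document; each statement's English description precedes it below -/
import Mathlib

section
/- Let P be a monic complex polynomial of degree n ≥ 1. Then there exists an n×n unitary complex matrix whose characteristic polynomial is P if and only if for every monic complex polynomial D of degree m with 1 ≤ m ≤ n that divides P, there exists an m×m unitary complex matrix whose characteristic polynomial is D. -/
/-- Every root of the characteristic polynomial of a unitary matrix has modulus one. -/
theorem norm_eq_one_of_isRoot_charpoly {n : Type*} [Fintype n] [DecidableEq n]
    {U : Matrix n n ℂ} (hU : U ∈ Matrix.unitaryGroup n ℂ) {z : ℂ}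
    (hz : U.charpoly.IsRoot z) : ‖z‖ = 1 := by
  open scoped Matrix.Norms.L2Operator in
  exact spectrum.norm_eq_one_of_unitary hU (Matrix.mem_spectrum_iff_isRoot_charpoly.mpr hz)

/-- A monic polynomial whose roots all have modulus one is the characteristic polynomial of a
unitary (diagonal) matrix. -/
theorem exists_unitary_charpoly_eq {m : ℕ} {D : Polynomial ℂ} (hD : D.Monic)
    (hdeg : D.natDegree = m) (hroots : ∀ z, D.IsRoot z → ‖z‖ = 1) :
    ∃ V : Matrix (Fin m) (Fin m) ℂ, V ∈ Matrix.unitaryGroup (Fin m) ℂ ∧ V.charpoly = D := by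
  have hsplits : D.Splits := IsAlgClosed.splits D
  obtain ⟨l, hl⟩ := Quotient.exists_rep D.roots
  replace hl : (l : Multiset ℂ) = D.roots := hl
  have hlen : l.length = m := by
    rw [← Multiset.coe_card, hl, ← hsplits.natDegree_eq_card_roots, hdeg]
  subst hlen
  refine ⟨Matrix.diagonal l.get, ?_, ?_⟩
  · rw [Matrix.mem_unitaryGroup_iff, Matrix.star_eq_conjTranspose, Matrix.diagonal_conjTranspose,
      Matrix.diagonal_mul_diagonal, Matrix.diagonal_eq_one]
    funext i
    have hmem : l.get i ∈ D.roots := by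
      rw [← hl]
      exact List.get_mem l i
    have hnorm := hroots _ (Polynomial.isRoot_of_mem_roots hmem)
    simp only [Pi.star_apply, Pi.one_apply, RCLike.star_def, Complex.mul_conj', hnorm]
    simp
  · rw [Matrix.charpoly_diagonal]
    conv_rhs => rw [hsplits.eq_prod_roots_of_monic hD, ← hl]
    rw [Multiset.map_coe, Multiset.prod_coe, ← List.prod_ofFn]
    congr 1
    exact List.ext_get (by simp) (by simp)


/-- a monic complex polynomial of degree n ≥ 1 admits a unitary ACM iff
every monic divisor of degree m, 1 ≤ m ≤ n, admits a unitary ACM. -/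
theorem stmt13 (n : ℕ) (hn : 1 ≤ n) (P : Polynomial ℂ)
    (hP : P.Monic) (hdeg : P.natDegree = n) :
    (∃ U : Matrix (Fin n) (Fin n) ℂ,
        U ∈ Matrix.unitaryGroup (Fin n) ℂ ∧ U.charpoly = P) ↔
    (∀ m : ℕ, 1 ≤ m → m ≤ n → ∀ D : Polynomial ℂ,
        D.Monic → D.natDegree = m → D ∣ P →
        ∃ V : Matrix (Fin m) (Fin m) ℂ,
          V ∈ Matrix.unitaryGroup (Fin m) ℂ ∧ V.charpoly = D) := by
  constructor
  · rintro ⟨U, hU, rfl⟩ m - - D hD hm hdvd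
    exact exists_unitary_charpoly_eq hD hm
      fun z hz => norm_eq_one_of_isRoot_charpoly hU (hz.dvd hdvd)
  · intro h
    exact h n hn le_rfl P hP hdeg dvd_rfl
end

section
/- A monic complex polynomial of degree 2 is the characteristic polynomial of some 2×2 unitary complex matrix if and only if it has the form z² - r₂e^{iϑ}z + e^{2iϑ} for some real numbers r₂ ∈ [0,2] and ϑ ∈ (-π, π]. -/
open Polynomial

/-- The trace of a `2 × 2` unitary matrix, in terms of its determinant and its first entry. -/
lemma trace_eq_of_mem_unitaryGroup_fin_two {U : Matrix (Fin 2) (Fin 2) ℂ}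
    (hU : U ∈ Matrix.unitaryGroup (Fin 2) ℂ) :
    U.trace = U 0 0 + U.det * star (U 0 0) := by
  have h : U.adjugate = U.det • star U := by
    calc U.adjugate = U.adjugate * (U * star U) := by
          rw [Matrix.mem_unitaryGroup_iff.mp hU, mul_one]
      _ = U.det • star U := by
          rw [← mul_assoc, Matrix.adjugate_mul, smul_mul_assoc, one_mul]
  have h00 := congrFun (congrFun h 0) 0
  simp only [Matrix.adjugate_fin_two, Matrix.of_apply, Matrix.cons_val', Matrix.cons_val_zero,
    Matrix.smul_apply, Matrix.star_apply, smul_eq_mul] at h00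
  rw [Matrix.trace_fin_two, h00]

lemma exp_I_mul_arg_of_norm_eq_one {v : ℂ} (hv : ‖v‖ = 1) :
    Complex.exp (Complex.I * (v.arg : ℂ)) = v := by
  have h := Complex.norm_mul_exp_arg_mul_I v
  rwa [hv, Complex.ofReal_one, one_mul, mul_comm] at h

lemma exp_two_mul_I_mul (z : ℂ) :
    Complex.exp (2 * Complex.I * z) = Complex.exp (Complex.I * z) ^ 2 := by
  rw [← Complex.exp_nat_mul]
  congr 1
  push_cast
  ring

/-- The trace of a `2 × 2` unitary matrix is a real number in `[0, 2]` times a square root of its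
determinant. -/
lemma exists_trace_det_of_mem_unitaryGroup_fin_two {U : Matrix (Fin 2) (Fin 2) ℂ}
    (hU : U ∈ Matrix.unitaryGroup (Fin 2) ℂ) :
    ∃ (r : ℝ) (v : ℂ), 0 ≤ r ∧ r ≤ 2 ∧ ‖v‖ = 1 ∧ U.trace = r * v ∧ U.det = v ^ 2 := by
  obtain ⟨w, hwd⟩ := IsAlgClosed.exists_pow_nat_eq U.det two_pos
  have hw : U.det = w ^ 2 := hwd.symm
  have hdet : ‖U.det‖ = 1 := CStarRing.norm_of_mem_unitary (Matrix.det_of_mem_unitary hU)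
  have hwn : ‖w‖ = 1 := by
    rw [hw, norm_pow] at hdet
    exact (pow_eq_one_iff_of_nonneg (norm_nonneg w) two_ne_zero).mp hdet
  have hww : w * star w = 1 := by
    have h := Complex.mul_conj' w
    simpa [hwn] using h
  set t : ℝ := 2 * (U 0 0 * star w).re with ht
  have htr : U.trace = t * w := by
    have h := Complex.add_conj (U 0 0 * star w)
    rw [trace_eq_of_mem_unitaryGroup_fin_two hU, hw, ht, ← h]
    simp only [starRingEnd_apply, star_mul', star_star]
    linear_combination (-(U 0 0)) * hww
  have htn : |t| ≤ 2 := by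
    have h1 : |(U 0 0 * star w).re| ≤ ‖U 0 0 * star w‖ := Complex.abs_re_le_norm _
    rw [norm_mul, norm_star, hwn, mul_one] at h1
    have h2 : ‖U 0 0‖ ≤ 1 := entry_norm_bound_of_unitary hU 0 0
    rw [ht, abs_mul, abs_two]
    linarith
  rcases le_total 0 t with h | h
  · exact ⟨t, w, h, (abs_le.mp htn).2, hwn, htr, hw⟩
  · refine ⟨-t, -w, by linarith, by linarith [(abs_le.mp htn).1], by rwa [norm_neg], ?_, ?_⟩
    · rw [htr]; push_cast; ring
    · rw [hw]; ring

/-- Every real number in `[0, 2]` is the sum of a complex number of norm one and its conjugate. -/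
lemma exists_add_star_eq_of_abs_le_two {r : ℝ} (h0 : 0 ≤ r) (h2 : r ≤ 2) :
    ∃ u : ℂ, u * star u = 1 ∧ u + star u = r := by
  have hs : Real.sqrt (1 - (r / 2) ^ 2) ^ 2 = 1 - (r / 2) ^ 2 := Real.sq_sqrt (by nlinarith)
  refine ⟨⟨r / 2, Real.sqrt (1 - (r / 2) ^ 2)⟩, ?_, ?_⟩
  · apply Complex.ext
    · simp only [Complex.mul_re, Complex.star_def, Complex.conj_re, Complex.conj_im,
        Complex.one_re]
      linear_combination hs
    · simp only [Complex.mul_im, Complex.star_def, Complex.conj_re, Complex.conj_im,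
        Complex.one_im]
      ring
  · apply Complex.ext <;> simp

/-- characterization of characteristic polynomials of 2×2 unitary matrices. -/
theorem stmt15 (P : Polynomial ℂ) (hP : P.Monic) (hdeg : P.natDegree = 2) :
    (∃ U : Matrix (Fin 2) (Fin 2) ℂ,
        U ∈ Matrix.unitaryGroup (Fin 2) ℂ ∧ U.charpoly = P) ↔
    (∃ r₂ ϑ : ℝ, 0 ≤ r₂ ∧ r₂ ≤ 2 ∧ -Real.pi < ϑ ∧ ϑ ≤ Real.pi ∧
      P = X ^ 2 - C ((r₂ : ℂ) * Complex.exp (Complex.I * (ϑ : ℂ))) * X +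
        C (Complex.exp (2 * Complex.I * (ϑ : ℂ)))) := by
  constructor
  · rintro ⟨U, hU, rfl⟩
    obtain ⟨r, v, hr0, hr2, hv, htr, hdet⟩ := exists_trace_det_of_mem_unitaryGroup_fin_two hU
    refine ⟨r, v.arg, hr0, hr2, Complex.neg_pi_lt_arg v, Complex.arg_le_pi v, ?_⟩
    rw [exp_two_mul_I_mul, exp_I_mul_arg_of_norm_eq_one hv, Matrix.charpoly_fin_two, htr, hdet]
  · rintro ⟨r, ϑ, hr0, hr2, -, -, rfl⟩
    obtain ⟨u, hu, hur⟩ := exists_add_star_eq_of_abs_le_two hr0 hr2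
    rw [exp_two_mul_I_mul]
    set v := Complex.exp (Complex.I * (ϑ : ℂ)) with hv
    have hvv : v * star v = 1 := by
      have hn : ‖v‖ = 1 := by rw [hv, mul_comm, Complex.norm_exp_ofReal_mul_I]
      have h := Complex.mul_conj' v
      simpa [hn] using h
    refine ⟨!![v * u, 0; 0, v * star u], ?_, ?_⟩
    · rw [Matrix.mem_unitaryGroup_iff]
      have h1 : v * u * star (v * u) = 1 := by
        rw [star_mul']; linear_combination u * star u * hvv + hu
      have h2 : v * star u * star (v * star u) = 1 := by
        rw [star_mul', star_star]; linear_combination u * star u * hvv + hu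
      simp only [star_mul', Complex.star_def, Complex.conj_conj] at h1 h2
      ext i j
      fin_cases i <;> fin_cases j <;>
        simp only [Matrix.mul_apply, Fin.sum_univ_two, Matrix.star_apply] <;>
        simp [h1, h2]
    · have htr : v * u + v * star u = r * v := by linear_combination v * hur
      have hdet : v * u * (v * star u) = v ^ 2 := by linear_combination v ^ 2 * hu
      rw [Matrix.charpoly_fin_two, Matrix.trace_fin_two_of, Matrix.det_fin_two_of, htr,
        hdet, mul_zero, sub_zero]
end

section
/- For every real r₂ ∈ [0,2] and every real θ, the 3×3 complex matrix W̃₃ = [[ (r₂/2)e^{iθ/2}, √(1-(r₂/2)²)·e^{iθ/2}, 0 ], [ -√(1-(r₂/2)²)·e^{iθ/2}, (r₂/2)e^{iθ/2}, 0 ], [ 0, 0, 1 ]] is unitary, and its characteristic polynomial is det(zI₃ - W̃₃) = z³ - (1 + r₂e^{iθ/2})z² + (1 + r₂e^{-iθ/2})e^{iθ}z - e^{iθ}. -/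
/-- the matrix W̃₃ is unitary with characteristic polynomial
z³ - (1 + r₂e^{iθ/2})z² + (1 + r₂e^{-iθ/2})e^{iθ}z - e^{iθ}. -/
theorem stmt19 (r₂ θ : ℝ) (h0 : 0 ≤ r₂) (h2 : r₂ ≤ 2)
    (W : Matrix (Fin 3) (Fin 3) ℂ)
    (hW : W = !![((r₂ : ℂ) / 2) * Complex.exp (Complex.I * (θ : ℂ) / 2),
                 (Real.sqrt (1 - (r₂ / 2) ^ 2) : ℂ) * Complex.exp (Complex.I * (θ : ℂ) / 2), 0;
                 -((Real.sqrt (1 - (r₂ / 2) ^ 2) : ℂ) * Complex.exp (Complex.I * (θ : ℂ) / 2)),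
                 ((r₂ : ℂ) / 2) * Complex.exp (Complex.I * (θ : ℂ) / 2), 0;
                 0, 0, 1]) :
    W ∈ Matrix.unitaryGroup (Fin 3) ℂ ∧
      ∀ z : ℂ, (z • (1 : Matrix (Fin 3) (Fin 3) ℂ) - W).det =
        z ^ 3 - (1 + (r₂ : ℂ) * Complex.exp (Complex.I * (θ : ℂ) / 2)) * z ^ 2 +
          (1 + (r₂ : ℂ) * Complex.exp (-(Complex.I * (θ : ℂ) / 2))) *
            Complex.exp (Complex.I * (θ : ℂ)) * z -
          Complex.exp (Complex.I * (θ : ℂ)) := by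
  have hs : ((Real.sqrt (1 - (r₂ / 2) ^ 2) : ℝ) : ℂ) ^ 2 = 1 - ((r₂ : ℂ) / 2) ^ 2 := by
    have h : Real.sqrt (1 - (r₂ / 2) ^ 2) ^ 2 = 1 - (r₂ / 2) ^ 2 :=
      Real.sq_sqrt (by nlinarith)
    exact_mod_cast congrArg (fun x : ℝ => (x : ℂ)) h
  have he : Complex.exp (Complex.I * (θ : ℂ) / 2) * Complex.exp (-(Complex.I * (θ : ℂ) / 2)) =
      1 := by
    rw [← Complex.exp_add, add_neg_cancel, Complex.exp_zero]
  have hsq : Complex.exp (Complex.I * (θ : ℂ)) = Complex.exp (Complex.I * (θ : ℂ) / 2) ^ 2 := by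
    rw [sq, ← Complex.exp_add, add_halves]
  have h_two : (starRingEnd ℂ) 2 = 2 := Complex.conj_ofNat 2
  have hconj : (starRingEnd ℂ) (Complex.exp (Complex.I * (θ : ℂ) / 2)) =
      Complex.exp (-(Complex.I * (θ : ℂ) / 2)) := by
    rw [← Complex.exp_conj]
    congr 1
    simp [neg_div, h_two]
  rw [hsq]
  generalize Complex.exp (-(Complex.I * (θ : ℂ) / 2)) = f at *
  generalize Complex.exp (Complex.I * (θ : ℂ) / 2) = e at *
  generalize Real.sqrt (1 - (r₂ / 2) ^ 2) = s at *
  subst hW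
  constructor
  · rw [Matrix.mem_unitaryGroup_iff]
    ext i j
    fin_cases i <;> fin_cases j <;>
      simp [Matrix.mul_apply, Fin.sum_univ_three, Matrix.star_apply, hconj, h_two]
    all_goals first
      | linear_combination e * f * hs + he
      | ring
  · intro z
    simp [Matrix.det_fin_three]
    linear_combination (z - 1) * e ^ 2 * hs - r₂ * e * z * he
end
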